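/- arXiv:2309.15364 — 2 statements merged into one kernel-verified Lean document; each statement's English description precedes it below -/
import Mathlib

section
/- Let F = ℚ(q,d₁,d₄,Λ,x) be the field of rational functions over ℚ in the indeterminates q, d₁, d₄, Λ, x. Let m, n ∈ ℕ and let i be an integer with −n ≤ i ≤ m. For i ≤ k ≤ m define r^{UW}_{i,k} := q^{(i−k)(2m+1+i−k)/2} (−d₄)^{k−i} · (q;q)_{m−i}/((q;q)_{k−i}(q;q)_{m−k}) · (d₁Λ q^{i−k−n};q)_{k−i} (d₁d₄Λ q^{−m−n−1};q)_{m−k} / (d₄ q^{−m};q)_{m−i}. Then (−d₁ q^{i−m} x;q)_{m−i} = Σ_{k=i}^{m} r^{UW}_{i,k} · (−q^{n+1+k−m} x/Λ;q)_{m−k} · (−q^{i+n+1} x/(Λ d₄);q)_{k−i}. -/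
open Finset

/-- The `q`-shifted factorial `(a;q)_n = ∏_{i=0}^{n-1} (1 - a q^i)`. -/
noncomputable def qPoch {F : Type*} [Field F] (q a : F) (n : ℕ) : F :=
  ∏ i ∈ Finset.range n, (1 - a * q ^ i)

/-- The field `F = ℚ(q,d₁,d₄,Λ,x)` of rational functions over `ℚ` in five indeterminates. -/
noncomputable abbrev F1 : Type := FractionRing (MvPolynomial (Fin 5) ℚ)

section QAnalogue

variable {K : Type*} [Field K]

theorem qPoch_zero (q a : K) : qPoch q a 0 = 1 := by simp [qPoch]

theorem qPoch_succ (q a : K) (n : ℕ) :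
    qPoch q a (n + 1) = qPoch q a n * (1 - a * q ^ n) := by
  simp [qPoch, Finset.prod_range_succ]

theorem qPoch_succ' (q a : K) (n : ℕ) :
    qPoch q a (n + 1) = (1 - a) * qPoch q (a * q) n := by
  simp only [qPoch, Finset.prod_range_succ', pow_zero, mul_one, pow_succ']
  rw [mul_comm]
  simp only [mul_assoc]

theorem qPoch_self_ne_zero {q : K} (hq : ∀ n : ℕ, q ^ (n + 1) ≠ 1) (n : ℕ) :
    qPoch q q n ≠ 0 := by
  refine Finset.prod_ne_zero_iff.mpr fun t _ h => hq t ?_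
  rw [pow_succ']
  exact (sub_eq_zero.mp h).symm

/-- Reversal of the factors of a `q`-shifted factorial. -/
theorem qPoch_mul_zpow_neg {q : K} (hq : q ≠ 0) (z : K) (n : ℕ) :
    qPoch q (z * q ^ (-(n : ℤ))) n = qPoch q⁻¹ (z * q⁻¹) n := by
  unfold qPoch
  rw [← Finset.prod_range_reflect]
  refine Finset.prod_congr rfl fun t ht => ?_
  obtain ⟨s, rfl⟩ := Nat.exists_eq_add_of_lt (Finset.mem_range.mp ht)
  rw [show t + s + 1 - 1 - t = s by omega, zpow_neg, zpow_natCast, inv_pow]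
  field_simp
  ring

theorem prod_sub_mul_pow {q D : K} (hq : q ≠ 0) (hD : D ≠ 0) (w : K) (n : ℕ) :
    ∏ t ∈ Finset.range n, (w - D * q ^ t) =
      q ^ n.choose 2 * (-D) ^ n * qPoch q⁻¹ (w / D) n := by
  induction n with
  | zero => simp [qPoch]
  | succ n ih =>
    rw [Finset.prod_range_succ, ih, qPoch_succ, Nat.choose_succ_succ' n 1, Nat.choose_one_right,
      inv_pow]
    field_simp
    ring

/-- The summand, with index `j` out of `j + e`, of the `q`-Saalschütz sum in polynomial form. -/
noncomputable def saalTerm (q a D y : K) (j e : ℕ) : K :=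
  qPoch q q (j + e) / (qPoch q q j * qPoch q q e) *
    (qPoch q⁻¹ a j * qPoch q (a * D) e * qPoch q⁻¹ y e *
      ∏ t ∈ Finset.range j, (y * q⁻¹ ^ e - D * q ^ t))

/-- The telescoping companion of `saalTerm`. -/
noncomputable def saalCert (q a D y : K) (j e : ℕ) : K :=
  -((q ^ j - a) * (y - D * q ^ e) * saalTerm q a D (y * q⁻¹) j e)

theorem prod_sub_mul_pow_succ {q : K} (hq : q ≠ 0) (D w : K) (j : ℕ) :
    ∏ t ∈ Finset.range (j + 1), (w - D * q ^ t) =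
      (w - D) * (q ^ j * ∏ t ∈ Finset.range j, (w * q⁻¹ - D * q ^ t)) := by
  rw [Finset.prod_range_succ', mul_comm, pow_zero, mul_one, ← Finset.card_range j,
    ← Finset.prod_const, Finset.card_range, ← Finset.prod_mul_distrib]
  congr 1
  refine Finset.prod_congr rfl fun t _ => ?_
  field_simp
  ring

theorem saalTerm_zero_succ {q : K} (hq : ∀ n : ℕ, q ^ (n + 1) ≠ 1) (a D y : K) (N : ℕ) :
    saalTerm q a D y 0 (N + 1) =
      (1 - D * q ^ N) * (1 - a * y) * saalTerm q a D (y * q⁻¹) 0 N + saalCert q a D y 0 N := by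
  have h0 := qPoch_self_ne_zero hq N
  have h1 := qPoch_self_ne_zero hq (N + 1)
  simp only [saalCert, saalTerm, Nat.zero_add, qPoch_zero, one_mul, div_self h0, div_self h1,
    Finset.range_zero, Finset.prod_empty, qPoch_succ q (a * D), qPoch_succ' q⁻¹ y]
  ring

theorem saalTerm_succ_zero {q : K} (hq0 : q ≠ 0) (hq : ∀ n : ℕ, q ^ (n + 1) ≠ 1)
    (a D y : K) (N : ℕ) :
    saalTerm q a D y (N + 1) 0 = -saalCert q a D y N 0 := by
  have h0 := qPoch_self_ne_zero hq N
  have h1 := qPoch_self_ne_zero hq (N + 1)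
  simp only [saalCert, saalTerm, Nat.add_zero, qPoch_zero, mul_one, div_self h0, div_self h1,
    pow_zero, prod_sub_mul_pow_succ hq0, qPoch_succ q⁻¹ a, inv_pow]
  field_simp

theorem saalTerm_succ_succ {q : K} (hq0 : q ≠ 0) (hq : ∀ n : ℕ, q ^ (n + 1) ≠ 1)
    (a D y : K) (j e : ℕ) :
    saalTerm q a D y (j + 1) (e + 1) =
      (1 - D * q ^ (j + 1 + e)) * (1 - a * y) * saalTerm q a D (y * q⁻¹) (j + 1) e +
        saalCert q a D y (j + 1) e - saalCert q a D y j (e + 1) := by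
  have hj := qPoch_self_ne_zero hq j
  have he := qPoch_self_ne_zero hq e
  have hj' : 1 - q * q ^ j ≠ 0 := by
    rw [← pow_succ']; exact sub_ne_zero.mpr (hq j).symm
  have he' : 1 - q * q ^ e ≠ 0 := by
    rw [← pow_succ']; exact sub_ne_zero.mpr (hq e).symm
  have hp : ∏ t ∈ Finset.range j, (y * q⁻¹ * q⁻¹ ^ (e + 1) - D * q ^ t) =
      ∏ t ∈ Finset.range j, (y * q⁻¹ ^ (e + 1) * q⁻¹ - D * q ^ t) := by
    refine Finset.prod_congr rfl fun t _ => ?_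
    ring
  have hp' : y * q⁻¹ * q⁻¹ ^ e = y * q⁻¹ ^ (e + 1) := by ring
  simp only [saalCert, saalTerm]
  rw [hp, hp', prod_sub_mul_pow_succ hq0, qPoch_succ' q⁻¹ y, qPoch_succ q⁻¹ (y * q⁻¹),
    qPoch_succ q⁻¹ a, qPoch_succ q (a * D), qPoch_succ q q j, qPoch_succ q q e,
    show j + 1 + (e + 1) = j + 1 + e + 1 by ring, qPoch_succ q q (j + 1 + e),
    show j + (e + 1) = j + 1 + e by ring, pow_add q (j + 1) e, pow_succ q j, pow_succ q e]
  simp only [inv_pow, pow_succ q e]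
  have hj0 : q ^ j ≠ 0 := pow_ne_zero _ hq0
  have he0 : q ^ e ≠ 0 := pow_ne_zero _ hq0
  generalize ∏ t ∈ Finset.range j, (y * (q ^ e * q)⁻¹ * q⁻¹ - D * q ^ t) = X
  generalize qPoch q q (j + 1 + e) = A at *
  generalize qPoch q q j = B at *
  generalize qPoch q q e = C at *
  generalize qPoch q⁻¹ a j = E
  generalize qPoch q (a * D) e = G
  generalize qPoch q⁻¹ (y * q⁻¹) e = H
  generalize q ^ j = u at *
  generalize q ^ e = v at *
  field_simp
  ring

theorem sum_range_saalTerm {q : K} (hq0 : q ≠ 0) (hq : ∀ n : ℕ, q ^ (n + 1) ≠ 1)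
    (a D y : K) (N M : ℕ) (hM : M ≤ N) :
    ∑ j ∈ Finset.range (M + 1), saalTerm q a D y j (N + 1 - j) =
      (1 - D * q ^ N) * (1 - a * y) *
        ∑ j ∈ Finset.range (M + 1), saalTerm q a D (y * q⁻¹) j (N - j) +
          saalCert q a D y M (N - M) := by
  induction M with
  | zero => simpa using saalTerm_zero_succ hq a D y N
  | succ M ih =>
    obtain ⟨e, rfl⟩ := Nat.exists_eq_add_of_le hM
    rw [Finset.sum_range_succ, ih (by omega), Finset.sum_range_succ _ (M + 1),
      show M + 1 + e + 1 - (M + 1) = e + 1 by omega, show M + 1 + e - (M + 1) = e by omega,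
      show M + 1 + e - M = e + 1 by omega, saalTerm_succ_succ hq0 hq]
    ring

/-- The `q`-Saalschütz summation in polynomial form. -/
theorem sum_saalTerm {q : K} (hq0 : q ≠ 0) (hq : ∀ n : ℕ, q ^ (n + 1) ≠ 1)
    (a D y : K) (N : ℕ) :
    ∑ j ∈ Finset.range (N + 1), saalTerm q a D y j (N - j) =
      qPoch q D N * qPoch q⁻¹ (a * y) N := by
  induction N generalizing y with
  | zero => simp [saalTerm, qPoch]
  | succ N ih =>
    rw [Finset.sum_range_succ, sum_range_saalTerm hq0 hq a D y N N le_rfl, ih,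
      Nat.sub_self, Nat.sub_self, saalTerm_succ_zero hq0 hq, qPoch_succ q D,
      qPoch_succ' q⁻¹ (a * y)]
    ring_nf

theorem int_mul_div_two (j m : ℕ) :
    -(j : ℤ) * (2 * (m : ℤ) + 1 - j) / 2 = (j.choose 2 : ℤ) - j * m := by
  apply Int.ediv_eq_of_eq_mul_left two_ne_zero
  have h : (j.choose 2 : ℤ) * 2 = j * (j - 1) := by
    induction j with
    | zero => simp
    | succ j ih =>
      rw [Nat.choose_succ_succ' j 1, Nat.choose_one_right]
      push_cast
      linarith
  linear_combination -h

theorem qPoch_transition {q d₁ d₄ Λ : K} (hq0 : q ≠ 0) (hq : ∀ n : ℕ, q ^ (n + 1) ≠ 1)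
    (hd₄ : d₄ ≠ 0) (hΛ : Λ ≠ 0) (x : K) (m n : ℕ)
    (hne : ∀ t : ℕ, d₄ * q ^ t ≠ q ^ m) (i : ℤ) (hi : i ≤ (m : ℤ)) :
    qPoch q (-d₁ * q ^ (i - (m : ℤ)) * x) ((m : ℤ) - i).toNat =
      ∑ k ∈ Finset.Icc i (m : ℤ),
        (q ^ ((i - k) * (2 * (m : ℤ) + 1 + i - k) / 2) * (-d₄) ^ (k - i).toNat *
            (qPoch q q ((m : ℤ) - i).toNat /
              (qPoch q q (k - i).toNat * qPoch q q ((m : ℤ) - k).toNat)) *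
            (qPoch q (d₁ * Λ * q ^ (i - k - (n : ℤ))) (k - i).toNat *
              qPoch q (d₁ * d₄ * Λ * q ^ (-(m : ℤ) - (n : ℤ) - 1)) ((m : ℤ) - k).toNat /
              qPoch q (d₄ * q ^ (-(m : ℤ))) ((m : ℤ) - i).toNat)) *
          qPoch q (-(q ^ ((n : ℤ) + 1 + k - (m : ℤ))) * x / Λ) ((m : ℤ) - k).toNat *
          qPoch q (-(q ^ (i + (n : ℤ) + 1)) * x / (Λ * d₄)) (k - i).toNat := by
  obtain ⟨N, hN⟩ := Int.eq_ofNat_of_zero_le (sub_nonneg.mpr hi)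
  obtain rfl : i = m - N := by omega
  set D : K := d₄ * q ^ (-(m : ℤ)) with hD
  have hD0 : D ≠ 0 := mul_ne_zero hd₄ (zpow_ne_zero _ hq0)
  have hDN : qPoch q D N ≠ 0 := by
    refine Finset.prod_ne_zero_iff.mpr fun t _ h => hne t ?_
    have h' := sub_eq_zero.mp h
    rw [hD, zpow_neg, zpow_natCast] at h'
    field_simp at h'
    exact h'.symm
  set a : K := d₁ * Λ * q ^ (-(n : ℤ)) with ha
  set y : K := -(q ^ ((n : ℤ) + 1) * x / Λ) with hy
  have key := sum_saalTerm hq0 hq (a * q⁻¹) D (y * q⁻¹) N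
  have hl : -d₁ * q ^ ((m : ℤ) - N - m) * x = a * q⁻¹ * y * q ^ (-(N : ℤ)) := by
    rw [ha, hy, show (m : ℤ) - N - m = -N by ring, zpow_add₀ hq0, zpow_one, zpow_neg q n]
    field_simp
  rw [hN, Int.toNat_natCast, hl, qPoch_mul_zpow_neg hq0,
    mul_assoc (a * q⁻¹) y, eq_div_of_mul_eq hDN ((mul_comm _ _).trans key.symm), Finset.sum_div]
  refine Finset.sum_bij' (fun j _ => (m : ℤ) - N + j) (fun k _ => (k - (m - N)).toNat)
    ?_ ?_ ?_ ?_ ?_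
  · intro j hj
    rw [Finset.mem_range] at hj
    rw [Finset.mem_Icc]
    omega
  · intro k hk
    rw [Finset.mem_Icc] at hk
    rw [Finset.mem_range]
    omega
  · intro j _
    omega
  · intro k hk
    rw [Finset.mem_Icc] at hk
    omega
  · intro j hj
    obtain ⟨e, rfl⟩ := Nat.exists_eq_add_of_le (Nat.lt_succ_iff.mp (Finset.mem_range.mp hj))
    have e1 : ((m : ℤ) - ((j + e : ℕ) : ℤ) + j - (m - ((j + e : ℕ) : ℤ))).toNat = j := by omega
    have e2 : ((m : ℤ) - (m - ((j + e : ℕ) : ℤ) + j)).toNat = e := by omega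
    have e3 : ((m : ℤ) - ((j + e : ℕ) : ℤ) - (m - ((j + e : ℕ) : ℤ) + j)) *
        (2 * (m : ℤ) + 1 + (m - ((j + e : ℕ) : ℤ)) - (m - ((j + e : ℕ) : ℤ) + j)) / 2 =
        (j.choose 2 : ℤ) - j * m := by
      rw [← int_mul_div_two]
      congr 1
      ring
    have f1 : d₁ * Λ * q ^ ((m : ℤ) - ((j + e : ℕ) : ℤ) - (m - ((j + e : ℕ) : ℤ) + j) - n) =
        a * q ^ (-(j : ℤ)) := by
      rw [ha, mul_assoc (d₁ * Λ), ← zpow_add₀ hq0]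
      congr 2
      ring
    have f2 : d₁ * d₄ * Λ * q ^ (-(m : ℤ) - n - 1) = a * q⁻¹ * D := by
      rw [ha, hD, sub_eq_add_neg, sub_eq_add_neg, zpow_add₀ hq0, zpow_add₀ hq0, zpow_neg_one]
      ring
    have f3 : -(q ^ ((n : ℤ) + 1 + (m - ((j + e : ℕ) : ℤ) + j) - m)) * x / Λ =
        y * q ^ (-(e : ℤ)) := by
      rw [hy, show (n : ℤ) + 1 + (m - ((j + e : ℕ) : ℤ) + j) - m = n + 1 + -e by push_cast; ring,
        zpow_add₀ hq0 _ (-(e : ℤ))]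
      ring
    have f4 : -(q ^ ((m : ℤ) - ((j + e : ℕ) : ℤ) + n + 1)) * x / (Λ * d₄) =
        y * q⁻¹ * q⁻¹ ^ e / D * q * q ^ (-(j : ℤ)) := by
      rw [hy, hD, show (m : ℤ) - ((j + e : ℕ) : ℤ) + n + 1 = n + 1 + m + -e + -j by push_cast; ring,
        zpow_add₀ hq0 _ (-(j : ℤ)), zpow_add₀ hq0 _ (-(e : ℤ)), zpow_add₀ hq0 _ (m : ℤ),
        zpow_neg q m, zpow_neg q e, zpow_natCast q e, inv_pow]
      field_simp
    have f5 : q ^ ((j.choose 2 : ℤ) - j * m) * (-d₄) ^ j = q ^ j.choose 2 * (-D) ^ j := by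
      rw [hD, ← neg_mul, mul_pow, zpow_sub₀ hq0, zpow_natCast, zpow_neg, zpow_natCast,
        ← Nat.cast_mul, zpow_natCast, inv_pow, ← pow_mul, mul_comm m j]
      ring
    rw [e1, e2, e3, f1, f2, f3, f4, f5, qPoch_mul_zpow_neg hq0, qPoch_mul_zpow_neg hq0,
      qPoch_mul_zpow_neg hq0, mul_inv_cancel_right₀ hq0, saalTerm, Nat.add_sub_cancel_left,
      prod_sub_mul_pow hq0 hD0]
    ring

end QAnalogue

/-- the upper-triangular transition
`(-d₁ q^{i-m} x;q)_{m-i} = Σ_{k=i}^{m} r^{UW}_{i,k} (-q^{n+1+k-m}x/Λ;q)_{m-k}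
  (-q^{i+n+1}x/(Λ d₄);q)_{k-i}` with the factorized coefficients `r^{UW}_{i,k}`. -/
theorem statement1
    (q d₁ d₄ Λ x : F1)
    (hq : q = algebraMap (MvPolynomial (Fin 5) ℚ) F1 (MvPolynomial.X 0))
    (hd₁ : d₁ = algebraMap (MvPolynomial (Fin 5) ℚ) F1 (MvPolynomial.X 1))
    (hd₄ : d₄ = algebraMap (MvPolynomial (Fin 5) ℚ) F1 (MvPolynomial.X 2))
    (hΛ : Λ = algebraMap (MvPolynomial (Fin 5) ℚ) F1 (MvPolynomial.X 3))
    (hx : x = algebraMap (MvPolynomial (Fin 5) ℚ) F1 (MvPolynomial.X 4))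
    (m n : ℕ) (i : ℤ) (hi₁ : -(n : ℤ) ≤ i) (hi₂ : i ≤ (m : ℤ)) :
    qPoch q (-d₁ * q ^ (i - (m : ℤ)) * x) ((m : ℤ) - i).toNat =
      ∑ k ∈ Finset.Icc i (m : ℤ),
        (q ^ ((i - k) * (2 * (m : ℤ) + 1 + i - k) / 2) * (-d₄) ^ (k - i).toNat *
            (qPoch q q ((m : ℤ) - i).toNat /
              (qPoch q q (k - i).toNat * qPoch q q ((m : ℤ) - k).toNat)) *
            (qPoch q (d₁ * Λ * q ^ (i - k - (n : ℤ))) (k - i).toNat *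
              qPoch q (d₁ * d₄ * Λ * q ^ (-(m : ℤ) - (n : ℤ) - 1)) ((m : ℤ) - k).toNat /
              qPoch q (d₄ * q ^ (-(m : ℤ))) ((m : ℤ) - i).toNat)) *
          qPoch q (-(q ^ ((n : ℤ) + 1 + k - (m : ℤ))) * x / Λ) ((m : ℤ) - k).toNat *
          qPoch q (-(q ^ (i + (n : ℤ) + 1)) * x / (Λ * d₄)) (k - i).toNat := by
  have ne_of_eval (f : Fin 5 → ℚ) {p r : MvPolynomial (Fin 5) ℚ}
      (h : MvPolynomial.eval f p ≠ MvPolynomial.eval f r) :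
      algebraMap (MvPolynomial (Fin 5) ℚ) F1 p ≠ algebraMap (MvPolynomial (Fin 5) ℚ) F1 r :=
    fun hpr => h (congrArg _ (IsFractionRing.injective (MvPolynomial (Fin 5) ℚ) F1 hpr))
  refine qPoch_transition ?_ (fun t => ?_) ?_ ?_ x m n (fun t => ?_) i hi₂
  · rw [hq, ← map_zero (algebraMap (MvPolynomial (Fin 5) ℚ) F1)]
    exact ne_of_eval (fun _ => 1) (by simp)
  · rw [hq, ← map_pow, ← map_one (algebraMap (MvPolynomial (Fin 5) ℚ) F1)]
    refine ne_of_eval (fun _ => 2) ?_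
    simpa using (one_lt_pow₀ (one_lt_two (α := ℚ)) t.succ_ne_zero).ne'
  · rw [hd₄, ← map_zero (algebraMap (MvPolynomial (Fin 5) ℚ) F1)]
    exact ne_of_eval (fun _ => 1) (by simp)
  · rw [hΛ, ← map_zero (algebraMap (MvPolynomial (Fin 5) ℚ) F1)]
    exact ne_of_eval (fun _ => 1) (by simp)
  · rw [hq, hd₄, ← map_pow, ← map_pow, ← map_mul]
    exact ne_of_eval (fun s => if s = 2 then 2 else 1) (by simp)
end

section
/- Let F = ℚ(q,d₁,d₄,Λ) be the field of rational functions over ℚ in the indeterminates q, d₁, d₄, Λ. Let m, n ∈ ℕ, set N := m+n, z := Λ/q, α := q^{n}/d₁, β := q^{m}/d₄. Then for all integers i, j with −n ≤ i, j ≤ m, the coefficient r_{i,j}(Λ) := q^{−in} (Λ d₄)^{i+n} q^{j} Λ^{−j−n} Σ_{k=max(i, m−n−j)}^{m} r^{UW}_{i,k} r^{WV}_{k,j} (with r^{UW}, r^{WV} the explicit factorized transition coefficients of Section 2.1, as in the previous statement) equals d₁^{m−i} q^{(m+1)i} β^{−(j+n)} · (q;q)_N (α/z;q)_{m−i} (1/β;q)_{m−j}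 (β/z;q)_{j+n} / ((q;q)_{j+n} (q;q)_{m−j} (1/z;q)_N (1/β;q)_{m−i}) · Σ_{s=0}^{j+n} (q^{−j−n};q)_s (q^{i−m};q)_s (q^{1−N}z;q)_s (z/(αβ);q)_s q^{s} / ((q;q)_s (q^{−N};q)_s (q^{1+i−m}z/α;q)_s (q^{1−j−n}z/β;q)_s). -/
open Finset

/-- The transition coefficient `r^{UW}_{i,k}` of Section 2.1. -/
noncomputable def rUW {F : Type*} [Field F] (q d₁ d₄ Λ : F) (m n : ℕ) (i k : ℤ) : F :=
  q ^ ((i - k) * (2 * (m : ℤ) + 1 + i - k) / 2) * (-d₄) ^ (k - i).toNat *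
    (qPoch q q ((m : ℤ) - i).toNat /
      (qPoch q q (k - i).toNat * qPoch q q ((m : ℤ) - k).toNat)) *
    (qPoch q (d₁ * Λ * q ^ (i - k - (n : ℤ))) (k - i).toNat *
      qPoch q (d₁ * d₄ * Λ * q ^ (-(m : ℤ) - (n : ℤ) - 1)) ((m : ℤ) - k).toNat /
      qPoch q (d₄ * q ^ (-(m : ℤ))) ((m : ℤ) - i).toNat)

/-- The transition coefficient `r^{WV}_{k,j}` of Section 2.1. -/
noncomputable def rWV {F : Type*} [Field F] (q d₄ Λ : F) (m n : ℕ) (k j : ℤ) : F :=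
  q ^ ((j - k - (m : ℤ) - (n : ℤ) - 1) * (j + k - (m : ℤ) + (n : ℤ)) / 2) *
    (-Λ) ^ (j + k - (m : ℤ) + (n : ℤ)).toNat *
    (qPoch q q (k + (n : ℤ)).toNat /
      (qPoch q q (k + j - (m : ℤ) + (n : ℤ)).toNat * qPoch q q ((m : ℤ) - j).toNat)) *
    (qPoch q (q ^ ((m : ℤ) + 1) / (d₄ * Λ)) (k + j - (m : ℤ) + (n : ℤ)).toNat *
      qPoch q (q ^ (j + 1) / d₄) ((m : ℤ) - j).toNat /
      qPoch q (q ^ (-k - (n : ℤ)) * Λ) (k + (n : ℤ)).toNat)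

/-- The matrix entry `r_{i,j}(Λ)` of Section 2.1. -/
noncomputable def rMat {F : Type*} [Field F] (q d₁ d₄ Λ : F) (m n : ℕ) (i j : ℤ) : F :=
  q ^ (-(i * (n : ℤ))) * (Λ * d₄) ^ (i + (n : ℤ)) * q ^ j * Λ ^ (-(j + (n : ℤ))) *
    ∑ k ∈ Finset.Icc (max i ((m : ℤ) - (n : ℤ) - j)) (m : ℤ),
      rUW q d₁ d₄ Λ m n i k * rWV q d₄ Λ m n k j

/-- The field `F = ℚ(q,d₁,d₄,Λ)` of rational functions over `ℚ` in four indeterminates. -/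
noncomputable abbrev F4 : Type := FractionRing (MvPolynomial (Fin 4) ℚ)

lemma qPoch_add {F : Type*} [Field F] (q a : F) (r s : ℕ) :
    qPoch q a (r + s) = qPoch q a r * ∏ i ∈ Finset.range s, (1 - a * q ^ (r + i)) := by
  simp only [qPoch, Finset.prod_range_add]

/-- Splitting off the last `s` factors of a `q`-shifted factorial and reversing them. -/
lemma qPoch_add_reverse {F : Type*} [Field F] {q y : F} (hq : q ≠ 0) (hy : y ≠ 0) (r s : ℕ) :
    qPoch q y (r + s) = qPoch q y r * qPoch q (q ^ (1 - (r : ℤ) - s) / y) s *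
      ((-1) ^ s * (y ^ s * q ^ (r * s + s.choose 2))) := by
  have h : ∏ i ∈ Finset.range s, (1 - y * q ^ (r + i)) =
      ∏ i ∈ Finset.range s,
        ((1 - q ^ (1 - (r : ℤ) - s) / y * q ^ i) * ((-1) * y * q ^ (r + (s - 1 - i)))) := by
    rw [← Finset.prod_range_reflect]
    refine Finset.prod_congr rfl fun i hi => ?_
    have his : i < s := Finset.mem_range.mp hi
    obtain ⟨t, rfl⟩ : ∃ t, s = i + 1 + t := ⟨s - (i + 1), by omega⟩
    have e1 : i + 1 + t - 1 - i = t := by omega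
    have e2 : q ^ (1 - (r : ℤ) - ((i + 1 + t : ℕ) : ℤ)) * q ^ i * q ^ (r + t) = 1 := by
      rw [← zpow_natCast, ← zpow_natCast, ← zpow_add₀ hq, ← zpow_add₀ hq]
      convert zpow_zero q using 2
      push_cast
      ring
    rw [e1]
    calc 1 - y * q ^ (r + t)
        = q ^ (1 - (r : ℤ) - ((i + 1 + t : ℕ) : ℤ)) * q ^ i * q ^ (r + t) - y * q ^ (r + t) := by
          rw [e2]
      _ = _ := by field_simp; ring
  rw [qPoch_add, h, Finset.prod_mul_distrib, Finset.prod_mul_distrib, Finset.prod_const,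
    Finset.card_range, Finset.prod_range_reflect (fun i => q ^ (r + i)), Finset.prod_pow_eq_pow_sum,
    Finset.sum_add_distrib, Finset.sum_const, Finset.card_range, Finset.sum_range_id,
    Nat.choose_two_right, mul_pow, smul_eq_mul, mul_comm s r]
  simp only [qPoch]
  ring

lemma qPoch_reverse {F : Type*} [Field F] {q y : F} (hq : q ≠ 0) (hy : y ≠ 0) (s : ℕ) :
    qPoch q y s = qPoch q (q ^ (1 - (s : ℤ)) / y) s * ((-1) ^ s * (y ^ s * q ^ s.choose 2)) := by
  simpa [qPoch] using qPoch_add_reverse hq hy 0 s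

lemma qPoch_inv_pow_eq_zero {F : Type*} [Field F] {q : F} (hq : q ≠ 0) {a s : ℕ} (h : a < s) :
    qPoch q (q ^ (-(a : ℤ))) s = 0 := by
  refine Finset.prod_eq_zero (Finset.mem_range.mpr h) ?_
  rw [zpow_neg, zpow_natCast, inv_mul_cancel₀ (pow_ne_zero _ hq), sub_self]

lemma mul_pred_ediv_two (a : ℕ) (x : ℤ) :
    ((a : ℤ) * (a - 1) + 2 * x) / 2 = (a.choose 2 : ℤ) + x := by
  rw [Int.add_mul_ediv_left _ _ two_ne_zero, Nat.choose_two_right]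
  rcases a with _ | a
  · simp
  · push_cast
    simp

lemma choose_two_mul_two_int (a : ℕ) : (a.choose 2 : ℤ) * 2 = a * (a - 1) := by
  induction a with
  | zero => simp
  | succ a ih =>
    rw [Nat.choose_succ_succ' a 1, Nat.choose_one_right]
    push_cast
    linear_combination ih

/-- Matching of individual summands on the two sides. -/
lemma prefactor_mul_rUW_mul_rWV {F : Type*} [Field F] {q z α β : F}
    (hq : q ≠ 0) (hz : z ≠ 0) (hα : α ≠ 0) (hβ : β ≠ 0)
    {m n a b c p : ℕ} (hn : m + n = b + p + c)
    (hqq : ∀ k, qPoch q q k ≠ 0) (hz' : ∀ k, qPoch q (1 / z) k ≠ 0)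
    (hαz : ∀ k, qPoch q (α / z) k ≠ 0) (hβz : ∀ k, qPoch q (β / z) k ≠ 0)
    (hβ' : ∀ k, qPoch q (1 / β) k ≠ 0) {d₁ d₄ Λ : F} (hd₁ : d₁ = q ^ n / α)
    (hd₄ : d₄ = q ^ m / β) (hΛ : Λ = q * z) {i j k : ℤ} (hi : i = m - a - p) (hj : j = m - c)
    (hk : k = m - p) :
    q ^ (-(i * (n : ℤ))) * (Λ * d₄) ^ (i + (n : ℤ)) * q ^ j * Λ ^ (-(j + (n : ℤ))) *
      (rUW q d₁ d₄ Λ m n i k * rWV q d₄ Λ m n k j) =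
    d₁ ^ (a + p) * q ^ (((m : ℤ) + 1) * i) * β ^ (-(j + (n : ℤ))) *
          (qPoch q q (m + n) * qPoch q (α / z) (a + p) *
              qPoch q (1 / β) c * qPoch q (β / z) (b + p) /
            (qPoch q q (b + p) * qPoch q q c *
              qPoch q (1 / z) (m + n) * qPoch q (1 / β) (a + p))) *
            (qPoch q (q ^ (-(j + (n : ℤ)))) p * qPoch q (q ^ (i - (m : ℤ))) p *
                qPoch q (q ^ (1 - ((m + n : ℕ) : ℤ)) * z) p * qPoch q (z / (α * β)) p * q ^ p /
              (qPoch q q p * qPoch q (q ^ (-((m + n : ℕ) : ℤ))) p *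
                qPoch q (q ^ (1 + i - (m : ℤ)) * z / α) p *
                qPoch q (q ^ (1 - j - (n : ℤ)) * z / β) p)) := by
  have hn' : (n : ℤ) = b + p + c - m := by omega
  have R1 := qPoch_add_reverse hq hq b p
  have R2 := qPoch_add_reverse hq hq a p
  have R3 := qPoch_add_reverse hq hq (b + c) p
  have R4 := qPoch_add_reverse hq (one_div_ne_zero hz) (b + c) p
  have R5 := qPoch_add_reverse hq (div_ne_zero hα hz) a p
  have R6 := qPoch_add_reverse hq (div_ne_zero hβ hz) b p
  have R7 := qPoch_reverse hq (div_ne_zero hα hz) a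
  have R8 := qPoch_reverse hq (one_div_ne_zero hβ) c
  have R9 := qPoch_reverse hq (one_div_ne_zero hz) (b + c)
  have hN : m + n = b + c + p := by omega
  have e1 : q ^ (1 - (b : ℤ) - p) / q = q ^ (-(j + (n : ℤ))) := by
    rw [div_eq_mul_inv, ← zpow_sub_one₀ hq]; congr 1; rw [hj, hn']; ring
  have e2 : q ^ (1 - (a : ℤ) - p) / q = q ^ (i - (m : ℤ)) := by
    rw [div_eq_mul_inv, ← zpow_sub_one₀ hq]; congr 1; rw [hi]; ring
  have e3 : q ^ (1 - ((b + c : ℕ) : ℤ) - p) / q = q ^ (-((m + n : ℕ) : ℤ)) := by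
    rw [div_eq_mul_inv, ← zpow_sub_one₀ hq]; congr 1; rw [hN]; push_cast; ring
  have e4 : q ^ (1 - ((b + c : ℕ) : ℤ) - p) / (1 / z) = q ^ (1 - ((m + n : ℕ) : ℤ)) * z := by
    rw [div_div_eq_mul_div, div_one]; congr 2; rw [hN]; push_cast; ring
  have e5 : q ^ (1 - (a : ℤ) - p) / (α / z) = q ^ (1 + i - (m : ℤ)) * z / α := by
    rw [div_div_eq_mul_div]; congr 3; rw [hi]; ring
  have e6 : q ^ (1 - (b : ℤ) - p) / (β / z) = q ^ (1 - j - (n : ℤ)) * z / β := by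
    rw [div_div_eq_mul_div]; congr 3; rw [hj, hn']; ring
  have e7 : q ^ (1 - (a : ℤ)) / (α / z) = d₁ * Λ * q ^ (i - k - (n : ℤ)) := by
    rw [hd₁, hΛ, show i - k - (n : ℤ) = - a - n by rw [hi, hk]; ring, zpow_sub₀ hq, zpow_sub₀ hq, zpow_neg,
      zpow_natCast, zpow_natCast, zpow_one]
    field_simp
  have e8 : q ^ (1 - (c : ℤ)) / (1 / β) = q ^ (j + 1) / d₄ := by
    rw [hd₄, hj, show (m : ℤ) - c + 1 = 1 - c + m by ring, zpow_add₀ hq, zpow_natCast]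
    field_simp
  have e9 : q ^ (1 - ((b + c : ℕ) : ℤ)) / (1 / z) = q ^ (-k - (n : ℤ)) * Λ := by
    rw [hΛ, show -k - (n : ℤ) = 1 - ((b + c : ℕ) : ℤ) - 1 by rw [hk, hn']; push_cast; ring,
      zpow_sub_one₀ hq]
    field_simp
  have e10 : d₁ * d₄ * Λ * q ^ (-(m : ℤ) - (n : ℤ) - 1) = z / (α * β) := by
    rw [hd₁, hd₄, hΛ, zpow_sub_one₀ hq, zpow_sub₀ hq, zpow_neg, zpow_natCast, zpow_natCast]
    field_simp
  have e11 : d₄ * q ^ (-(m : ℤ)) = 1 / β := by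
    rw [hd₄, zpow_neg, zpow_natCast]
    field_simp
  have e12 : q ^ ((m : ℤ) + 1) / (d₄ * Λ) = β / z := by
    rw [hd₄, hΛ, zpow_add_one₀ hq, zpow_natCast]
    field_simp
  rw [hN] at e3 e4
  have t1 : (k - i).toNat = a := by omega
  have t2 : ((m : ℤ) - k).toNat = p := by omega
  have t3 : ((m : ℤ) - i).toNat = a + p := by omega
  have t4 : ((m : ℤ) - j).toNat = c := by omega
  have t5 : (k + (n : ℤ)).toNat = b + c := by omega
  have t6 : (k + j - (m : ℤ) + (n : ℤ)).toNat = b := by omega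
  have t7 : (j + k - (m : ℤ) + (n : ℤ)).toNat = b := by omega
  have x1 : (i - k) * (2 * (m : ℤ) + 1 + i - k) / 2 = a.choose 2 - a * m := by
    rw [show (i - k) * (2 * (m : ℤ) + 1 + i - k) = a * (a - 1) + 2 * (-(a * m)) by
      rw [hi, hk]; ring, mul_pred_ediv_two]
    ring
  have x2 : (j - k - (m : ℤ) - (n : ℤ) - 1) * (j + k - (m : ℤ) + (n : ℤ)) / 2 =
      b.choose 2 - b * (b + c) := by
    rw [show (j - k - (m : ℤ) - (n : ℤ) - 1) * (j + k - (m : ℤ) + (n : ℤ)) =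
      b * (b - 1) + 2 * (-(b * (b + c))) by rw [hj, hk, hn']; ring, mul_pred_ediv_two]
    ring
  rw [e1] at R1; rw [e2] at R2; rw [e3] at R3; rw [e4] at R4; rw [e5] at R5; rw [e6] at R6
  rw [e7] at R7; rw [e8] at R8; rw [e9] at R9
  unfold rUW rWV
  rw [t1, t2, t3, t4, t5, t6, t7, e10, e11, e12, x1, x2]
  have h1 := hqq (b + p)
  have h2 := hqq (a + p)
  have h3 := hqq (m + n)
  have h4 := hz' (m + n)
  have h5 := hαz (a + p)
  have h6 := hβz (b + p)
  have h9 := hz' (b + c)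
  have g1 := hqq c
  have g2 := hqq p
  have g3 := hβ' (a + p)
  rw [hN] at h3 h4 ⊢
  rw [R8]
  rw [R9] at h9 R4
  rw [R7] at R5
  rw [R1] at h1 ⊢
  rw [R2] at h2 ⊢
  rw [R3] at h3 ⊢
  rw [R4] at h4 ⊢
  rw [R5] at h5 ⊢
  rw [R6] at h6 ⊢
  clear R1 R2 R3 R4 R5 R6 R7 R8 R9 e1 e2 e3 e4 e5 e6 e7 e8 e9 e10 e11 e12 hqq hz' hαz hβz hβ'
  obtain ⟨W, hW⟩ : ∃ W : ℤ → ℤ → ℤ → ℤ → F,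
    ∀ u v w x, W u v w x = q ^ u * z ^ v * α ^ w * β ^ x := ⟨_, fun _ _ _ _ => rfl⟩
  have W_mul (u v w x u' v' w' x' : ℤ) :
      W u v w x * W u' v' w' x' = W (u + u') (v + v') (w + w') (x + x') := by
    simp only [hW, zpow_add₀ hq, zpow_add₀ hz, zpow_add₀ hα, zpow_add₀ hβ]
    ring
  have W_zpow (u v w x t : ℤ) : W u v w x ^ t = W (u * t) (v * t) (w * t) (x * t) := by
    simp only [hW, mul_zpow, zpow_mul]
  have W_pow (u v w x : ℤ) (t : ℕ) : W u v w x ^ t = W (u * t) (v * t) (w * t) (x * t) := by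
    rw [← zpow_natCast, W_zpow]
  have Wq : q = W 1 0 0 0 := by simp [hW]
  have Wβ : β = W 0 0 0 1 := by simp [hW]
  have Wd₁ : d₁ = W n 0 (-1) 0 := by simp [hW, hd₁, div_eq_mul_inv]
  have Wd₄ : d₄ = W m 0 0 (-1) := by simp [hW, hd₄, div_eq_mul_inv]
  have WΛ : Λ = W 1 1 0 0 := by simp [hW, hΛ]
  have Wz : 1 / z = W 0 (-1) 0 0 := by simp [hW]
  have Wα : α / z = W 0 (-1) 1 0 := by simp [hW, div_eq_mul_inv, mul_comm]
  have Wβz : β / z = W 0 (-1) 0 1 := by simp [hW, div_eq_mul_inv, mul_comm]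
  have Wβi : 1 / β = W 0 0 0 (-1) := by simp [hW]
  have hchoose : ((b + c).choose 2 : ℤ) = b.choose 2 + c.choose 2 + b * c := by
    have h := choose_two_mul_two_int (b + c)
    push_cast at h
    linarith [choose_two_mul_two_int b, choose_two_mul_two_int c]
  rw [neg_pow d₄, neg_pow Λ]
  have key : (q ^ (-(i * (n : ℤ))) * (Λ * d₄) ^ (i + (n : ℤ)) * q ^ j * Λ ^ (-(j + (n : ℤ)))) *
      (q ^ ((a.choose 2 : ℤ) - a * m) * d₄ ^ a) * (q ^ ((b.choose 2 : ℤ) - b * (b + c)) * Λ ^ b) *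
      (q ^ p * q ^ (a * p + p.choose 2)) * (q ^ p * q ^ (b * p + p.choose 2)) *
      ((1 / z) ^ p * q ^ ((b + c) * p + p.choose 2)) *
      ((1 / z) ^ (b + c) * q ^ (b + c).choose 2) =
      (d₁ ^ (a + p) * q ^ (((m : ℤ) + 1) * i) * β ^ (-(j + (n : ℤ)))) * q ^ p *
      (q ^ p * q ^ ((b + c) * p + p.choose 2)) * ((α / z) ^ a * q ^ a.choose 2) *
      ((α / z) ^ p * q ^ (a * p + p.choose 2)) * ((1 / β) ^ c * q ^ c.choose 2) *
      ((β / z) ^ p * q ^ (b * p + p.choose 2)) := by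
    rw [Wz, Wα, Wβz, Wβi, WΛ, Wd₁, Wd₄, Wq, Wβ]
    simp only [W_mul, W_pow, W_zpow]
    push_cast
    rw [hchoose, hi, hj, hn']
    congr 1
    · linear_combination choose_two_mul_two_int b
    all_goals ring
  have sb : ((-1 : F) ^ b) ^ 2 = 1 := by rw [← pow_mul, mul_comm, pow_mul]; simp
  rw [pow_add (-1 : F) b c] at *
  generalize q ^ (-(i * (n : ℤ))) * (Λ * d₄) ^ (i + (n : ℤ)) * q ^ j * Λ ^ (-(j + (n : ℤ))) = P
    at *
  generalize d₁ ^ (a + p) * q ^ (((m : ℤ) + 1) * i) * β ^ (-(j + (n : ℤ))) = P' at *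
  generalize q ^ p * q ^ (a * p + p.choose 2) = w₂ at *
  generalize q ^ p * q ^ (b * p + p.choose 2) = w₁,
    q ^ p * q ^ ((b + c) * p + p.choose 2) = w₃,
    (1 / z) ^ p * q ^ ((b + c) * p + p.choose 2) = w₄,
    (α / z) ^ p * q ^ (a * p + p.choose 2) = w₅,
    (β / z) ^ p * q ^ (b * p + p.choose 2) = w₆,
    (α / z) ^ a * q ^ a.choose 2 = w₇, (1 / β) ^ c * q ^ c.choose 2 = w₈,
    (1 / z) ^ (b + c) * q ^ (b + c).choose 2 = w₉,
    q ^ ((a.choose 2 : ℤ) - a * m) = u₁, q ^ ((b.choose 2 : ℤ) - b * (b + c)) = u₂,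
    d₄ ^ a = u₃, Λ ^ b = u₄ at *
  generalize q ^ p = u₅ at *
  generalize (-1 : F) ^ a = sga, (-1 : F) ^ b = sgb, (-1 : F) ^ c = sgc, (-1 : F) ^ p = sgp at *
  simp only [ne_eq, mul_eq_zero, not_or] at h1 h2 h3 h4 h5 h6 h9
  obtain ⟨⟨k1, k2⟩, k3, k4⟩ := h1
  obtain ⟨⟨k5, k6⟩, -, k7⟩ := h2
  obtain ⟨⟨k8, k9⟩, -, k10⟩ := h3
  obtain ⟨⟨⟨k11, ⟨k12, k13⟩, k14⟩, k15⟩, -, k16⟩ := h4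
  obtain ⟨⟨⟨k17, k18, k19⟩, k20⟩, -, k21⟩ := h5
  obtain ⟨⟨k22, k23⟩, -, k24⟩ := h6
  clear h9
  generalize qPoch q q b = A1, qPoch q (q ^ (-(j + (n : ℤ)))) p = A2, qPoch q q a = A3,
    qPoch q (q ^ (i - (m : ℤ))) p = A4, qPoch q q (b + c) = A5,
    qPoch q (q ^ (-((b + c + p : ℕ) : ℤ))) p = A6, qPoch q (q ^ (-k - (n : ℤ)) * Λ) (b + c) = A7,
    qPoch q (q ^ (1 - ((b + c + p : ℕ) : ℤ)) * z) p = A8,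
    qPoch q (d₁ * Λ * q ^ (i - k - (n : ℤ))) a = A9,
    qPoch q (q ^ (1 + i - (m : ℤ)) * z / α) p = A10,
    qPoch q (β / z) b = A11, qPoch q (q ^ (1 - j - (n : ℤ)) * z / β) p = A12 at *
  field_simp
  rw [sb, mul_one]
  linear_combination qPoch q (z / (α * β)) p * qPoch q (q ^ (j + 1) / d₄) c * key

lemma qPoch_ne_zero {F : Type*} [Field F] {q a : F} (h : ∀ i : ℕ, a * q ^ i ≠ 1) (k : ℕ) :
    qPoch q a k ≠ 0 :=
  Finset.prod_ne_zero_iff.mpr fun i _ => sub_ne_zero.mpr (h i).symm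

lemma algebraMap_ne_of_eval_ne {P Q : MvPolynomial (Fin 4) ℚ} (x : Fin 4 → ℚ)
    (h : MvPolynomial.eval x P ≠ MvPolynomial.eval x Q) :
    algebraMap (MvPolynomial (Fin 4) ℚ) F4 P ≠ algebraMap (MvPolynomial (Fin 4) ℚ) F4 Q :=
  fun e => h (congrArg _ (IsFractionRing.injective (MvPolynomial (Fin 4) ℚ) F4 e))

/-- Remark 2.3, equation (2.14): identification of `r_{i,j}(Λ)` with the
hypergeometric `₄φ₃` expression `R^{HG}` for the R-matrix of the quantum affine algebra. -/
theorem statement4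
    (q d₁ d₄ Λ : F4)
    (hq : q = algebraMap (MvPolynomial (Fin 4) ℚ) F4 (MvPolynomial.X 0))
    (hd₁ : d₁ = algebraMap (MvPolynomial (Fin 4) ℚ) F4 (MvPolynomial.X 1))
    (hd₄ : d₄ = algebraMap (MvPolynomial (Fin 4) ℚ) F4 (MvPolynomial.X 2))
    (hΛ : Λ = algebraMap (MvPolynomial (Fin 4) ℚ) F4 (MvPolynomial.X 3))
    (m n N : ℕ) (hN : N = m + n)
    (z α β : F4) (hz : z = Λ / q) (hα : α = q ^ n / d₁) (hβ : β = q ^ m / d₄) :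
    ∀ i j : ℤ, -(n : ℤ) ≤ i → i ≤ (m : ℤ) → -(n : ℤ) ≤ j → j ≤ (m : ℤ) →
      rMat q d₁ d₄ Λ m n i j =
        d₁ ^ ((m : ℤ) - i) * q ^ (((m : ℤ) + 1) * i) * β ^ (-(j + (n : ℤ))) *
          (qPoch q q N * qPoch q (α / z) ((m : ℤ) - i).toNat *
              qPoch q (1 / β) ((m : ℤ) - j).toNat * qPoch q (β / z) (j + (n : ℤ)).toNat /
            (qPoch q q (j + (n : ℤ)).toNat * qPoch q q ((m : ℤ) - j).toNat *
              qPoch q (1 / z) N * qPoch q (1 / β) ((m : ℤ) - i).toNat)) *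
          ∑ s ∈ Finset.range ((j + (n : ℤ)).toNat + 1),
            qPoch q (q ^ (-(j + (n : ℤ)))) s * qPoch q (q ^ (i - (m : ℤ))) s *
                qPoch q (q ^ (1 - (N : ℤ)) * z) s * qPoch q (z / (α * β)) s * q ^ s /
              (qPoch q q s * qPoch q (q ^ (-(N : ℤ))) s *
                qPoch q (q ^ (1 + i - (m : ℤ)) * z / α) s *
                qPoch q (q ^ (1 - j - (n : ℤ)) * z / β) s) := by
  have X_ne (t : Fin 4) : algebraMap (MvPolynomial (Fin 4) ℚ) F4 (MvPolynomial.X t) ≠ 0 := by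
    rw [← map_zero (algebraMap (MvPolynomial (Fin 4) ℚ) F4)]
    exact algebraMap_ne_of_eval_ne 1 (by simp)
  have hq0 : q ≠ 0 := hq ▸ X_ne 0
  have hd₁0 : d₁ ≠ 0 := hd₁ ▸ X_ne 1
  have hd₄0 : d₄ ≠ 0 := hd₄ ▸ X_ne 2
  have hΛ0 : Λ ≠ 0 := hΛ ▸ X_ne 3
  have hz0 : z ≠ 0 := hz ▸ div_ne_zero hΛ0 hq0
  have hα0 : α ≠ 0 := hα ▸ div_ne_zero (pow_ne_zero _ hq0) hd₁0
  have hβ0 : β ≠ 0 := hβ ▸ div_ne_zero (pow_ne_zero _ hq0) hd₄0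
  have hqq : ∀ k, qPoch q q k ≠ 0 := by
    refine qPoch_ne_zero fun i e => ?_
    rw [hq, ← map_pow, ← map_mul, ← map_one (algebraMap (MvPolynomial (Fin 4) ℚ) F4)] at e
    exact algebraMap_ne_of_eval_ne 0 (by simp) e
  have hz' : ∀ k, qPoch q (1 / z) k ≠ 0 := by
    refine qPoch_ne_zero fun i e => ?_
    have e : q ^ (i + 1) = Λ := by
      rw [hz] at e
      field_simp at e
      linear_combination e
    rw [hq, hΛ, ← map_pow] at e
    exact algebraMap_ne_of_eval_ne ![0, 1, 1, 1] (by simp) e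
  have hαz : ∀ k, qPoch q (α / z) k ≠ 0 := by
    refine qPoch_ne_zero fun i e => ?_
    have e : q ^ (n + i + 1) = d₁ * Λ := by
      rw [hz, hα] at e
      field_simp at e
      linear_combination e
    rw [hq, hΛ, hd₁, ← map_pow, ← map_mul] at e
    exact algebraMap_ne_of_eval_ne ![0, 1, 1, 1] (by simp) e
  have hβz : ∀ k, qPoch q (β / z) k ≠ 0 := by
    refine qPoch_ne_zero fun i e => ?_
    have e : q ^ (m + i + 1) = d₄ * Λ := by
      rw [hz, hβ] at e
      field_simp at e
      linear_combination e
    rw [hq, hΛ, hd₄, ← map_pow, ← map_mul] at e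
    exact algebraMap_ne_of_eval_ne ![0, 1, 1, 1] (by simp) e
  have hβ' : ∀ k, qPoch q (1 / β) k ≠ 0 := by
    refine qPoch_ne_zero fun i e => ?_
    have e : d₄ * q ^ i = q ^ m := by
      rw [hβ] at e
      field_simp at e
      linear_combination e
    rw [hq, hd₄, ← map_pow, ← map_mul, ← map_pow] at e
    exact algebraMap_ne_of_eval_ne ![1, 1, 0, 1] (by simp) e
  have hd₁' : d₁ = q ^ n / α := by rw [hα, div_div_cancel₀ (pow_ne_zero _ hq0)]
  have hd₄' : d₄ = q ^ m / β := by rw [hβ, div_div_cancel₀ (pow_ne_zero _ hq0)]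
  have hΛ' : Λ = q * z := by rw [hz, mul_div_cancel₀ _ hq0]
  clear hq hd₁ hd₄ hΛ hz hα hβ X_ne
  intro i j hi hi' hj hj'
  subst hN
  rw [rMat, Finset.mul_sum, Finset.mul_sum]
  symm
  have hsub : Finset.range (min ((m : ℤ) - i).toNat (j + (n : ℤ)).toNat + 1) ⊆
      Finset.range ((j + (n : ℤ)).toNat + 1) :=
    Finset.range_subset_range.mpr (by omega)
  rw [← Finset.sum_subset hsub]
  · refine Finset.sum_bij' (fun s _ => (m : ℤ) - s) (fun k _ => ((m : ℤ) - k).toNat)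
      ?_ ?_ ?_ ?_ ?_
    · intro s hs
      rw [Finset.mem_range] at hs
      rw [Finset.mem_Icc]
      omega
    · intro k hk
      rw [Finset.mem_Icc] at hk
      rw [Finset.mem_range]
      omega
    · intro s hs
      omega
    · intro k hk
      rw [Finset.mem_Icc] at hk
      omega
    · intro s hs
      rw [Finset.mem_range] at hs
      obtain ⟨a, ha⟩ : ∃ a : ℕ, i = m - a - s := ⟨((m : ℤ) - i).toNat - s, by omega⟩
      obtain ⟨b, hb⟩ : ∃ b : ℕ, j + n = b + s := ⟨(j + (n : ℤ)).toNat - s, by omega⟩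
      obtain ⟨c, hc⟩ : ∃ c : ℕ, j = m - c := ⟨((m : ℤ) - j).toNat, by omega⟩
      rw [prefactor_mul_rUW_mul_rWV (a := a) (b := b) (c := c) (p := s) hq0 hz0 hα0 hβ0
        (by omega) hqq hz' hαz hβz hβ' hd₁' hd₄' hΛ' ha hc rfl]
      rw [show ((m : ℤ) - i).toNat = a + s by omega, show ((m : ℤ) - j).toNat = c by omega,
        show (j + (n : ℤ)).toNat = b + s by omega,
        show (m : ℤ) - i = ((a + s : ℕ) : ℤ) by push_cast; omega, zpow_natCast]
  · intro s hs hs'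
    rw [Finset.mem_range] at hs hs'
    have : i - (m : ℤ) = -(((m : ℤ) - i).toNat : ℤ) := by omega
    rw [this, qPoch_inv_pow_eq_zero hq0 (a := ((m : ℤ) - i).toNat) (s := s) (by omega)]
    simp
end
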